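/- There exists a constant c such that for every integer q and every string x with |x| < 2^q/2 − c: if C_V(x) ≤ q then |T_q(x)| ≥ 2^{2^q − q − c}, where T_q(x) = {s : C_V(x, s) ≤ 2^q} (low complexity implies large extension volume). -/

import Mathlib

open scoped Classical ENNReal

/-- Binary strings. -/
abbrev BStr := List Bool

/-- Plain Kolmogorov complexity of `x` with respect to a decompressor `D`
(a partial function from binary strings to binary strings):
the minimal length of a description `p` with `D p = x`. -/
noncomputable def plainC (D : BStr →. BStr) (x : BStr) : ℕ :=
  sInf {n | ∃ p : BStr, p.length = n ∧ x ∈ D p}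

/-- Conditional complexity of `x` given `y` with respect to a two-argument
decompressor `D` (first argument: program, second: condition). -/
noncomputable def condC (D : BStr → BStr →. BStr) (x y : BStr) : ℕ :=
  sInf {n | ∃ p : BStr, p.length = n ∧ x ∈ D p y}

/-- A fixed computable encoding of natural numbers as binary strings. -/
def natStr (n : ℕ) : BStr := Nat.bits n

/-- A fixed computable pairing function on binary strings. -/
def pairStr (x y : BStr) : BStr := natStr (Encodable.encode (x, y))

/-- A fixed computable encoding of triples of binary strings. -/
def tripStr (x y z : BStr) : BStr := natStr (Encodable.encode (x, y, z))

/-- An optimal (universal) plain decompressor `V`: a partial computable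
decompressor whose complexity function is minimal up to an additive constant
among all partial computable decompressors. -/
structure OptimalDecompressor where
  V : BStr →. BStr
  partrec : Partrec V
  onto : ∀ x : BStr, ∃ p : BStr, x ∈ V p
  optimal : ∀ D : BStr →. BStr, Partrec D → ∃ M : ℕ, ∀ x : BStr,
    (∃ p : BStr, x ∈ D p) → plainC V x ≤ plainC D x + M

/-- A universal two-argument decompressor for conditional plain complexity. -/
structure CondOptimalDecompressor where
  Vc : BStr → BStr →. BStr
  partrec : Partrec₂ Vc
  onto : ∀ x y : BStr, ∃ p : BStr, x ∈ Vc p y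
  optimal : ∀ D : BStr → BStr →. BStr, Partrec₂ D → ∃ M : ℕ, ∀ x y : BStr,
    (∃ p : BStr, x ∈ D p y) → condC Vc x y ≤ condC D x y + M

/-- A two-argument decompressor is prefix-free if for each condition `y`
its domain (in the program argument) is prefix-free. -/
def PrefixFreeDom (D : BStr → BStr →. BStr) : Prop :=
  ∀ y p q : BStr, (D p y).Dom → (D q y).Dom → p <+: q → p = q

/-- A universal prefix-free conditional decompressor, defining conditional
prefix complexity `K(x | y)`. -/
structure UniversalPrefixDecompressor where
  D : BStr → BStr →. BStr
  partrec : Partrec₂ D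
  prefixFree : PrefixFreeDom D
  onto : ∀ x y : BStr, ∃ p : BStr, x ∈ D p y
  universal : ∀ D' : BStr → BStr →. BStr, Partrec₂ D' → PrefixFreeDom D' →
    ∃ c : ℕ, ∀ x y : BStr, (∃ p : BStr, x ∈ D' p y) →
      condC D x y ≤ condC D' x y + c

/-- Conditional prefix complexity `K(x | y)` with respect to a universal
prefix-free conditional decompressor `U`. -/
noncomputable def K (U : UniversalPrefixDecompressor) (x y : BStr) : ℕ := condC U.D x y

/-- The canonical enumeration of all pairs `(x, k)` with `C_V(x) ≤ k`,
obtained by dovetailing the computations of `V` on all programs: a computable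
listing whose range is exactly the set of such pairs. -/
structure CanonicalEnum (V : BStr →. BStr) where
  e : ℕ → Option (BStr × ℕ)
  computable : Computable e
  mem_iff : ∀ x : BStr, ∀ k : ℕ, (∃ t, e t = some (x, k)) ↔ plainC V x ≤ k

/-- The moment of first appearance of string `x` in the canonical enumeration
as a pair `(x, k)` with `k ≤ n`. -/
noncomputable def strFirst {V : BStr →. BStr} (E : CanonicalEnum V) (x : BStr) (n : ℕ) : ℕ :=
  sInf {t | ∃ k ≤ n, E.e t = some (x, k)}

/-- `w` is the last string of complexity at most `n` (i.e. `w = w_n`):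
it has `C_V(w) ≤ n` and every string of complexity at most `n` appears
(as a pair with bound `≤ n`) no later than `w` does. -/
def IsLastSimple (O : OptimalDecompressor) (E : CanonicalEnum O.V) (n : ℕ) (w : BStr) : Prop :=
  plainC O.V w ≤ n ∧ ∀ x : BStr, plainC O.V x ≤ n → strFirst E x n ≤ strFirst E w n

/-- The extension set `T_t(y) = { s : C_V(y, s) ≤ 2^t }`. -/
def Tset (O : OptimalDecompressor) (t : ℕ) (y : BStr) : Set BStr :=
  {s | plainC O.V (pairStr y s) ≤ 2 ^ t}

/-- The relaxed extension set `T_t^δ(y) = { s : C_V(y, s) ≤ 2^t + δ }`. -/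
def TsetR (O : OptimalDecompressor) (t δ : ℕ) (y : BStr) : Set BStr :=
  {s | plainC O.V (pairStr y s) ≤ 2 ^ t + δ}

/-- The "past" set `St^w_t(y)`: extensions `s` with `C_V(y, s) ≤ 2^t` whose
pair appears in the canonical enumeration (with bound `≤ 2^t`) strictly
before `w = w_n` appears (with bound `≤ n`). -/
def StSet (O : OptimalDecompressor) (E : CanonicalEnum O.V) (t n : ℕ) (w : BStr)
    (y : BStr) : Set BStr :=
  {s | plainC O.V (pairStr y s) ≤ 2 ^ t ∧
       strFirst E (pairStr y s) (2 ^ t) < strFirst E w n}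

/-- The tower sequence `a_0 = 1`, `a_{i+1} = 2^{a_i}`. -/
def tower : ℕ → ℕ
  | 0 => 1
  | i + 1 => 2 ^ tower i

/-- `qt` is a structural witness for `q` relative to `n` with constant `c₀`:
it is short, effectively encodes `q`, and satisfies the complexity
decomposition `K(q̃ | n) = K(q̃, α, K(q̃, α | q) | n) + O(1)` where `α = K(q̃ | n)`. -/
def StructuralWitness (Oc : CondOptimalDecompressor) (U : UniversalPrefixDecompressor)
    (c₀ n q : ℕ) (qt : BStr) : Prop :=
  qt.length ≤ c₀ * Nat.log 2 q ∧
  condC Oc.Vc (natStr q) qt ≤ c₀ ∧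
  K U qt (natStr n) ≤
      K U (tripStr qt (natStr (K U qt (natStr n)))
        (natStr (K U (pairStr qt (natStr (K U qt (natStr n)))) (natStr q)))) (natStr n) + c₀ ∧
  K U (tripStr qt (natStr (K U qt (natStr n)))
        (natStr (K U (pairStr qt (natStr (K U qt (natStr n)))) (natStr q)))) (natStr n) ≤
      K U qt (natStr n) + c₀

theorem primrec_bits : Primrec Nat.bits := by
  have h : Primrec₂ (fun (_ : Unit) (n : ℕ) => Nat.bits n) := by
    refine Primrec.nat_strong_rec _ (g := fun _ L =>
      if L.length = 0 then some ([] : List Bool)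
      else (L[Nat.div2 L.length]?).map (fun l => Nat.bodd L.length :: l)) ?_ ?_
    · refine Primrec.ite ?_ (Primrec.const _) ?_
      · exact Primrec.eq.comp (Primrec.list_length.comp Primrec.snd) (Primrec.const 0)
      · refine Primrec.option_map ?_ ?_
        · exact Primrec.list_getElem?.comp Primrec.snd
            (Primrec.nat_div2.comp (Primrec.list_length.comp Primrec.snd))
        · exact Primrec.list_cons.comp
            (Primrec.nat_bodd.comp
              (Primrec.list_length.comp (Primrec.snd.comp Primrec.fst))) Primrec.snd
    · intro _ n
      rcases Nat.eq_zero_or_pos n with rfl | hn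
      · simp
      · have h2 : n.div2 < n := by rw [Nat.div2_val]; omega
        have h3 : n.bits = n.bodd :: n.div2.bits := by
          conv_lhs => rw [← Nat.bit_bodd_div2 n]
          apply Nat.bits_append_bit
          intro h0
          have := Nat.bodd_add_div2 n
          cases hb : n.bodd
          · simp [hb, h0] at this; omega
          · rfl
        have hne : n ≠ 0 := by omega
        simp [hne, h2, h3]
  exact h.comp (Primrec.const ()) Primrec.id

/-- number of header bits -/
def hdr (p : BStr) : ℕ := (Nat.bits p.length).length + 1

theorem primrec_hdr : Primrec hdr :=
  Primrec.succ.comp (Primrec.list_length.comp (primrec_bits.comp Primrec.list_length))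

/-- the program of `x` contained in the header -/
def hdrProg (p : BStr) : BStr := ((p.take (hdr p)).dropWhile (fun b => !b)).tail

theorem primrec_hdrProg : Primrec hdrProg :=
  Primrec.list_tail.comp ((Primrec.list_dropWhile Primrec.not).comp
    (Primrec.list_take.comp primrec_hdr Primrec.id))

theorem primrec_pairStr : Primrec₂ pairStr :=
  primrec_bits.comp (Primrec.encode.comp (Primrec.pair Primrec.fst Primrec.snd))

/-- the decompressor used in the proof -/
def extD (V : BStr →. BStr) (p : BStr) : Part BStr :=
  (V (hdrProg p)).map (fun x => pairStr x (p.drop (hdr p)))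

theorem partrec_extD {V : BStr →. BStr} (hV : Partrec V) : Partrec (extD V) := by
  refine Partrec.map (hV.comp primrec_hdrProg.to_comp) ?_
  refine Primrec₂.to_comp ?_
  exact primrec_pairStr.comp Primrec.snd
    (Primrec.list_drop.comp (primrec_hdr.comp Primrec.fst) Primrec.fst)

theorem pairStr_inj {x s t : BStr} (h : pairStr x s = pairStr x t) : s = t := by
  have hb : Function.Injective Nat.bits := by
    intro a
    induction a using Nat.strong_induction_on with
    | _ a ih =>
      intro b hab
      have h1 : a.bodd = b.bodd := by
        rw [Nat.bodd_eq_bits_head, Nat.bodd_eq_bits_head, hab]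
      have h2 : a.div2.bits = b.div2.bits := by
        rw [Nat.div2_bits_eq_tail, Nat.div2_bits_eq_tail, hab]
      rcases Nat.eq_zero_or_pos a with rfl | ha
      · have : b.size = 0 := by rw [← Nat.size_eq_bits_len, ← hab]; simp
        exact (Nat.size_eq_zero.1 this).symm
      · have h3 := ih a.div2 (by rw [Nat.div2_val]; omega) h2
        rw [← Nat.bit_bodd_div2 a, ← Nat.bit_bodd_div2 b, h1, h3]
  have := Encodable.encode_injective (hb h)
  exact (Prod.mk.inj this).2

theorem exists_prog (O : OptimalDecompressor) (x : BStr) :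
    ∃ p : BStr, p.length = plainC O.V x ∧ x ∈ O.V p := by
  obtain ⟨p, hp⟩ := O.onto x
  exact Nat.sInf_mem (s := {n | ∃ p : BStr, p.length = n ∧ x ∈ O.V p}) ⟨_, p, rfl, hp⟩

theorem Tset_finite (O : OptimalDecompressor) (q : ℕ) (x : BStr) : (Tset O q x).Finite := by
  choose f hf1 hf2 using fun s => exists_prog O (pairStr x s)
  refine Set.Finite.of_finite_image (f := f)
    ((List.finite_length_le Bool (2 ^ q)).subset ?_) ?_
  · rintro _ ⟨s, hs, rfl⟩
    exact (hf1 s).trans_le hs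
  · intro s _ t _ hst
    have h1 := hf2 s
    rw [hst] at h1
    exact pairStr_inj (Part.mem_unique h1 (hf2 t))

theorem ncard_length_eq (k : ℕ) : {l : BStr | l.length = k}.ncard = 2 ^ k := by
  have : Nat.card (List.Vector Bool k) = 2 ^ k := by
    rw [Nat.card_eq_fintype_card, card_vector]; simp
  exact this

/-- Low complexity implies large extension volume: there is a
constant `c` such that for every integer `q` and string `x` with
`|x| < 2^q/2 − c`: if `C_V(x) ≤ q` then `|T_q(x)| ≥ 2^{2^q − q − c}`. -/
theorem low_complexity_implies_large_volume (O : OptimalDecompressor) :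
    ∃ c : ℕ, ∀ q : ℕ, ∀ x : BStr, 2 * (x.length + c) < 2 ^ q →
      plainC O.V x ≤ q → 2 ^ (2 ^ q - q - c) ≤ (Tset O q x).ncard := by
  obtain ⟨M, hM⟩ := O.optimal (extD O.V) (partrec_extD O.partrec)
  refine ⟨M + 2, fun q x hlen hx => ?_⟩
  rw [← ncard_length_eq]
  refine Set.ncard_le_ncard ?_ (Tset_finite O q x)
  intro s hs
  have hs : s.length = 2 ^ q - q - (M + 2) := hs
  obtain ⟨r, hr1, hr2⟩ := exists_prog O x
  rw [← hr1] at hx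
  obtain ⟨m, rfl⟩ : ∃ m, q = m + 1 := by
    cases q with
    | zero => simp at hlen
    | succ m => exact ⟨m, rfl⟩
  have hm : m < 2 ^ m := Nat.lt_two_pow_self
  rw [pow_succ] at hlen hs
  obtain ⟨h, hh⟩ : ∃ h : BStr, h = List.replicate (m + 1 - r.length) false ++ true :: r :=
    ⟨_, rfl⟩
  have hhl : h.length = m + 2 := by simp [hh]; omega
  have hpl : (h ++ s).length = 2 * 2 ^ m - (M + 1) := by
    rw [List.length_append, hhl, hs]; omega
  have hhdr : hdr (h ++ s) = m + 2 := by
    unfold hdr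
    rw [Nat.size_eq_bits_len, hpl]
    have h1 : Nat.size (2 * 2 ^ m - (M + 1)) ≤ m + 1 := by
      rw [Nat.size_le, pow_succ]; omega
    have h2 : m < Nat.size (2 * 2 ^ m - (M + 1)) := by
      rw [Nat.lt_size]; omega
    omega
  have hprog : hdrProg (h ++ s) = r := by
    unfold hdrProg
    rw [hhdr, List.take_left' hhl, hh, List.dropWhile_append_of_pos]
    · simp
    · simp
  have hmem : pairStr x s ∈ extD O.V (h ++ s) := by
    unfold extD
    rw [hprog, hhdr, List.drop_left' hhl]
    exact Part.mem_map _ hr2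
  have hopt := hM (pairStr x s) ⟨_, hmem⟩
  have hD : plainC (extD O.V) (pairStr x s) ≤ (h ++ s).length :=
    Nat.sInf_le ⟨_, rfl, hmem⟩
  change plainC O.V (pairStr x s) ≤ 2 ^ (m + 1)
  rw [pow_succ]
  omega
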